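/- Let x₀ be a list of natural numbers with x₀.length = 4, and let a, j₁, b, j₂, c be natural numbers with 1 ≤ a ≤ 7, 1 ≤ j₁ ≤ 4, 1 ≤ b ≤ 3, 1 ≤ j₂ ≤ 6 - b, and 1 ≤ c ≤ 3. Define: x₂ = (x₀ ++ x₀).rotate a; x₃ = ((x₂.drop 3).take j₁) ++ (x₂.take 3) ++ ((x₂.drop 3).drop j₁); x₄ = x₃.tail; x₅ = ((x₄.drop b).take j₂) ++ (x₄.take b) ++ ((x₄.drop b).drop j₂); x₆ = x₅.drop c; x₇ = x₆.rotate 7; and h : List ℕ → List ℕ by h l = (l.eraseIdx 1).rotate 1. Then for every v, x₃.head? = some v implies h^[6 - c] x₇ = [v]; that is, the single number remaining at the end of the routine equals the number set aside at Step 5, regardless of x₀, a, j₁, b, j₂, and c. -/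

import Mathlib

def elimStep (l : List ℕ) : List ℕ := (l.eraseIdx 1).rotate 1

/-- Moving the first `b` elements strictly inside the list keeps its last element. -/
theorem getLast?_insert_middle {α : Type*} (l : List α) (b j : ℕ) (h : b + j < l.length) :
    ((l.drop b).take j ++ l.take b ++ (l.drop b).drop j).getLast? = l.getLast? := by
  rw [List.drop_drop, List.getLast?_append, List.getLast?_drop, if_neg (by omega),
    List.getLast?_eq_getElem?, List.getElem?_eq_getElem (by omega), Option.some_or]

theorem length_insert_middle {α : Type*} (l : List α) (b j : ℕ) :
    ((l.drop b).take j ++ l.take b ++ (l.drop b).drop j).length = l.length := by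
  simp only [List.length_append, List.length_take, List.length_drop]
  omega

/-- Rotating a doubled list of length four yields a doubled list. -/
theorem rotate_append_self {α : Type*} (l : List α) (hl : l.length = 4) (a : ℕ) :
    (l ++ l).rotate a = l.rotate a ++ l.rotate a := by
  induction a with
  | zero => simp
  | succ n ih =>
    rw [← List.rotate_rotate, ih, ← List.rotate_rotate]
    have hn : (l.rotate n).length = 4 := by rw [List.length_rotate, hl]
    generalize l.rotate n = m at hn
    cases m with
    | nil => rfl
    | cons x m => simp

/-- The elimination rounds leave exactly the last element of the list. -/
theorem elimStep_iterate_rotate_seven (l : List ℕ) (c v : ℕ) (hc1 : 1 ≤ c) (hc3 : c ≤ 3)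
    (hl : l.length = 7 - c) (hv : l.getLast? = some v) :
    elimStep^[6 - c] (l.rotate 7) = [v] := by
  obtain ⟨m, rfl⟩ := List.getLast?_eq_some_iff.mp hv
  rw [List.length_append, List.length_singleton] at hl
  interval_cases c
  · obtain ⟨p, q, r, s, t, rfl⟩ : ∃ p q r s t, m = [p, q, r, s, t] := by
      match m, hl with
      | [p, q, r, s, t], _ => exact ⟨p, q, r, s, t, rfl⟩
    simp [elimStep, List.rotate]
  · obtain ⟨p, q, r, s, rfl⟩ : ∃ p q r s, m = [p, q, r, s] := by
      match m, hl with
      | [p, q, r, s], _ => exact ⟨p, q, r, s, rfl⟩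
    simp [elimStep, List.rotate]
  · obtain ⟨p, q, r, rfl⟩ := List.length_eq_three.mp (show m.length = 3 by omega)
    simp [elimStep, List.rotate]

theorem state_agnostic_invariance
    (x₀ : List ℕ) (hx₀ : x₀.length = 4)
    (a j₁ b j₂ c : ℕ)
    (ha1 : 1 ≤ a) (ha7 : a ≤ 7)
    (hj₁1 : 1 ≤ j₁) (hj₁4 : j₁ ≤ 4)
    (hb1 : 1 ≤ b) (hb3 : b ≤ 3)
    (hj₂1 : 1 ≤ j₂) (hj₂ : j₂ ≤ 6 - b)
    (hc1 : 1 ≤ c) (hc3 : c ≤ 3)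
    (x₂ x₃ x₄ x₅ x₆ x₇ : List ℕ)
    (h₂ : x₂ = (x₀ ++ x₀).rotate a)
    (h₃ : x₃ = ((x₂.drop 3).take j₁) ++ (x₂.take 3) ++ ((x₂.drop 3).drop j₁))
    (h₄ : x₄ = x₃.tail)
    (h₅ : x₅ = ((x₄.drop b).take j₂) ++ (x₄.take b) ++ ((x₄.drop b).drop j₂))
    (h₆ : x₆ = x₅.drop c)
    (h₇ : x₇ = x₆.rotate 7) :
    ∀ v : ℕ, x₃.head? = some v → elimStep^[6 - c] x₇ = [v] := by
  intro v hv
  have hy : (x₀.rotate a).length = 4 := by rw [List.length_rotate, hx₀]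
  rw [rotate_append_self x₀ hx₀] at h₂
  generalize x₀.rotate a = y at h₂ hy
  have hx₂ : x₂.length = 8 := by rw [h₂, List.length_append, hy]
  have hends : x₃.head? = x₂.getLast? := by
    match y, hy with
    | [p, q, r, s], _ =>
      obtain ⟨j, rfl⟩ := Nat.exists_eq_add_of_le' hj₁1
      rw [h₃, h₂]
      rfl
  have hlen₃ : x₃.length = 8 := by rw [h₃, length_insert_middle, hx₂]
  have hlast₃ : x₃.getLast? = some v := by
    rw [h₃, getLast?_insert_middle _ _ _ (by omega), ← hends, hv]
  have hlen₄ : x₄.length = 7 := by rw [h₄, List.length_tail, hlen₃]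
  have hlast₄ : x₄.getLast? = some v := by
    rw [h₄, List.getLast?_tail, if_neg (by omega), hlast₃]
  have hlen₅ : x₅.length = 7 := by rw [h₅, length_insert_middle, hlen₄]
  have hlast₅ : x₅.getLast? = some v := by
    rw [h₅, getLast?_insert_middle _ _ _ (by omega), hlast₄]
  rw [h₇]
  refine elimStep_iterate_rotate_seven x₆ c v hc1 hc3 ?_ ?_
  · rw [h₆, List.length_drop, hlen₅]
  · rw [h₆, List.getLast?_drop, if_neg (by omega), hlast₅]
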